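/- arXiv:2203.10683 — 3 statements merged into one kernel-verified Lean document; each statement's English description precedes it below -/
import Mathlib

section
/- L¹-smoothness of the simulated probit outcome in the parameter: Let p ≥ 1, let (Ω, 𝓕, P) be a probability space, let x : Ω → ℝ^p be an integrable random vector (E‖x‖₂ < ∞), let α : Ω → ℝ be measurable, and let u : Ω → ℝ be standard normal and independent of the pair (x, α). Then for all θ₁, θ₂ ∈ ℝ^p, E|1{⟨x, θ₁⟩ + α ≥ u} − 1{⟨x, θ₂⟩ + α ≥ u}| ≤ (E‖x‖₂ / √(2π)) · ‖θ₁ − θ₂‖₂. -/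
open MeasureTheory ProbabilityTheory
open scoped RealInnerProductSpace
open scoped ENNReal NNReal

lemma gaussianPDFReal_le (m : ℝ) (v : ℝ≥0) (t : ℝ) :
    gaussianPDFReal m v t ≤ (√(2 * Real.pi * v))⁻¹ := by
  rw [gaussianPDFReal]
  refine mul_le_of_le_one_right (by positivity) (Real.exp_le_one_iff.2 ?_)
  rw [neg_div]
  exact neg_nonpos.2 (by positivity)

lemma gaussianReal_le_mul_volume (m : ℝ) {v : ℝ≥0} (hv : v ≠ 0) (s : Set ℝ) :
    gaussianReal m v s ≤ ENNReal.ofReal (√(2 * Real.pi * v))⁻¹ * volume s := by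
  rw [gaussianReal_apply m hv]
  calc ∫⁻ t in s, gaussianPDF m v t
      ≤ ∫⁻ _ in s, ENNReal.ofReal (√(2 * Real.pi * v))⁻¹ :=
        lintegral_mono fun t => ENNReal.ofReal_le_ofReal (gaussianPDFReal_le m v t)
    _ = _ := by simp

lemma measurableSet_mem_uIoc {Ω : Type*} [MeasurableSpace Ω] {u a b : Ω → ℝ}
    (hu : Measurable u) (ha : Measurable a) (hb : Measurable b) :
    MeasurableSet {ω | u ω ∈ Set.uIoc (a ω) (b ω)} :=
  (measurableSet_lt (ha.min hb) hu).inter (measurableSet_le hu (ha.max hb))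

/-- The probability that an independent variable `u`, whose law is bounded by `K` times Lebesgue
measure, falls between `a` and `b` is at most `K * E|b - a|`. -/
lemma measure_mem_uIoc_le_of_indepFun {Ω : Type*} [MeasurableSpace Ω] {P : Measure Ω}
    [IsFiniteMeasure P] {u a b : Ω → ℝ} (hu : Measurable u) (ha : Measurable a)
    (hb : Measurable b) (h_indep : IndepFun u (fun ω => (a ω, b ω)) P) {K : ℝ≥0∞}
    (hK : ∀ s, P.map u s ≤ K * volume s) :
    P {ω | u ω ∈ Set.uIoc (a ω) (b ω)} ≤ ∫⁻ ω, K * ENNReal.ofReal |b ω - a ω| ∂P := by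
  have hab : Measurable fun ω => (a ω, b ω) := ha.prodMk hb
  have hS : MeasurableSet {q : ℝ × ℝ × ℝ | q.1 ∈ Set.uIoc q.2.1 q.2.2} :=
    measurableSet_mem_uIoc (by fun_prop) (by fun_prop) (by fun_prop)
  calc P {ω | u ω ∈ Set.uIoc (a ω) (b ω)}
      = P.map (fun ω => (u ω, a ω, b ω)) {q | q.1 ∈ Set.uIoc q.2.1 q.2.2} :=
        (Measure.map_apply (hu.prodMk hab) hS).symm
    _ = ∫⁻ q, P.map u (Set.uIoc q.1 q.2) ∂P.map fun ω => (a ω, b ω) := by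
        rw [h_indep.map_prod_eq_prod_map_map hu.aemeasurable hab.aemeasurable,
          Measure.prod_apply_symm hS]
        rfl
    _ ≤ ∫⁻ q, K * ENNReal.ofReal |q.2 - q.1| ∂P.map fun ω => (a ω, b ω) :=
        lintegral_mono fun q => (hK _).trans_eq (by rw [Real.volume_uIoc])
    _ = ∫⁻ ω, K * ENNReal.ofReal |b ω - a ω| ∂P := lintegral_map (by fun_prop) hab

lemma abs_ite_le_sub_ite_eq_indicator_uIoc (t a b : ℝ) :
    |(if t ≤ a then (1 : ℝ) else 0) - (if t ≤ b then (1 : ℝ) else 0)|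
      = (Set.uIoc a b).indicator 1 t := by
  by_cases h₁ : t ≤ a <;> by_cases h₂ : t ≤ b <;>
    simp [Set.mem_uIoc, h₁, h₂, not_lt.2, not_le.1]

/-- **L¹-smoothness of the simulated probit outcome in the parameter.** If `x` is an
integrable random vector in `ℝ^p`, `α` a real random variable, and `u` standard normal and
independent of the pair `(x, α)`, then for all `θ₁ θ₂`,
`E|1{⟨x,θ₁⟩ + α ≥ u} − 1{⟨x,θ₂⟩ + α ≥ u}| ≤ (E‖x‖ / √(2π)) * ‖θ₁ − θ₂‖`. -/
theorem stmt6 {Ω : Type*} [MeasurableSpace Ω] (P : Measure Ω) [IsProbabilityMeasure P]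
    (p : ℕ) (hp : 1 ≤ p)
    (x : Ω → EuclideanSpace ℝ (Fin p)) (α : Ω → ℝ) (u : Ω → ℝ)
    (hx_meas : Measurable x) (hα_meas : Measurable α) (hu_meas : Measurable u)
    (hx_int : Integrable (fun ω => ‖x ω‖) P)
    (hu_dist : Measure.map u P = gaussianReal 0 1)
    (hu_indep : IndepFun u (fun ω => (x ω, α ω)) P)
    (θ₁ θ₂ : EuclideanSpace ℝ (Fin p)) :
    ∫ ω, |(if u ω ≤ ⟪x ω, θ₁⟫ + α ω then (1 : ℝ) else 0)
        - (if u ω ≤ ⟪x ω, θ₂⟫ + α ω then (1 : ℝ) else 0)| ∂P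
      ≤ ((∫ ω, ‖x ω‖ ∂P) / Real.sqrt (2 * Real.pi)) * ‖θ₁ - θ₂‖ := by
  have ha : Measurable fun ω => ⟪x ω, θ₁⟫ + α ω := by fun_prop
  have hb : Measurable fun ω => ⟪x ω, θ₂⟫ + α ω := by fun_prop
  have h_indep : IndepFun u (fun ω => (⟪x ω, θ₁⟫ + α ω, ⟪x ω, θ₂⟫ + α ω)) P :=
    hu_indep.comp (φ := id)
      (ψ := fun q : EuclideanSpace ℝ (Fin p) × ℝ => (⟪q.1, θ₁⟫ + q.2, ⟪q.1, θ₂⟫ + q.2))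
      measurable_id (by fun_prop)
  have hK (s : Set ℝ) : P.map u s ≤ ENNReal.ofReal (√(2 * Real.pi))⁻¹ * volume s := by
    simpa [hu_dist] using gaussianReal_le_mul_volume 0 one_ne_zero s
  have hS : MeasurableSet {ω | u ω ∈ Set.uIoc (⟪x ω, θ₁⟫ + α ω) (⟪x ω, θ₂⟫ + α ω)} :=
    measurableSet_mem_uIoc hu_meas ha hb
  have h_le (ω : Ω) : |⟪x ω, θ₂⟫ + α ω - (⟪x ω, θ₁⟫ + α ω)| ≤ ‖x ω‖ * ‖θ₁ - θ₂‖ := by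
    rw [add_sub_add_right_eq_sub, abs_sub_comm, ← inner_sub_right]
    exact abs_real_inner_le_norm _ _
  calc _ = ∫ ω, {ω | u ω ∈ Set.uIoc (⟪x ω, θ₁⟫ + α ω) (⟪x ω, θ₂⟫ + α ω)}.indicator 1 ω ∂P :=
        integral_congr_ae (.of_forall fun ω => abs_ite_le_sub_ite_eq_indicator_uIoc _ _ _)
    _ = P.real {ω | u ω ∈ Set.uIoc (⟪x ω, θ₁⟫ + α ω) (⟪x ω, θ₂⟫ + α ω)} :=
        integral_indicator_one hS
    _ ≤ ∫ ω, (√(2 * Real.pi))⁻¹ * (‖x ω‖ * ‖θ₁ - θ₂‖) ∂P := by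
        refine ENNReal.toReal_le_of_le_ofReal (integral_nonneg fun ω => by positivity) ?_
        rw [ofReal_integral_eq_lintegral_ofReal ((hx_int.mul_const _).const_mul _)
          (.of_forall fun ω => by positivity)]
        refine (measure_mem_uIoc_le_of_indepFun hu_meas ha hb h_indep hK).trans
          (lintegral_mono fun ω => ?_)
        rw [ENNReal.ofReal_mul (by positivity)]
        gcongr
        exact h_le ω
    _ = _ := by
        rw [integral_const_mul, integral_mul_const]
        ring
end

section
/- Expected band indicator bound: Let p ≥ 1, let x : Ω → ℝ^p be an integrable random vector (E‖x‖₂ < ∞), α : Ω → ℝ measurable, and u : Ω → ℝ standard normal and independent of the pair (x, α). Then for every θ ∈ ℝ^p and every δ ≥ 0, E[1{|u − ⟨x, θ⟩ − α| ≤ ‖x‖₂ · δ}] ≤ (2δ/√(2π)) · E‖x‖₂. -/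
open MeasureTheory ProbabilityTheory
open scoped RealInnerProductSpace

lemma gaussianReal_zero_one_closedBall_le (c r : ℝ) :
    gaussianReal 0 1 (Metric.closedBall c r)
      ≤ ENNReal.ofReal (2 / Real.sqrt (2 * Real.pi) * r) := by
  have hpdf : ∀ s, gaussianPDF 0 1 s ≤ ENNReal.ofReal (Real.sqrt (2 * Real.pi))⁻¹ := fun s ↦ by
    refine ENNReal.ofReal_le_ofReal ?_
    simp only [gaussianPDFReal, NNReal.coe_one, mul_one]
    refine mul_le_of_le_one_right (by positivity) (Real.exp_le_one_iff.2 ?_)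
    have := sq_nonneg (s - 0)
    linarith
  calc gaussianReal 0 1 (Metric.closedBall c r)
      = ∫⁻ s in Metric.closedBall c r, gaussianPDF 0 1 s := gaussianReal_apply 0 one_ne_zero _
    _ ≤ ∫⁻ _ in Metric.closedBall c r, ENNReal.ofReal (Real.sqrt (2 * Real.pi))⁻¹ :=
        lintegral_mono hpdf
    _ = ENNReal.ofReal (2 / Real.sqrt (2 * Real.pi) * r) := by
        rw [setLIntegral_const, Real.volume_closedBall, ← ENNReal.ofReal_mul (by positivity)]
        congr 1
        ring

lemma measure_abs_sub_le_of_indepFun_gaussian {Ω : Type*} [MeasurableSpace Ω]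
    {P : Measure Ω} [IsFiniteMeasure P] {u c r : Ω → ℝ}
    (hu : Measurable u) (hc : Measurable c) (hr : Measurable r)
    (hu_dist : Measure.map u P = gaussianReal 0 1) (h : IndepFun u (fun ω => (c ω, r ω)) P) :
    P {ω | |u ω - c ω| ≤ r ω}
      ≤ ∫⁻ ω, ENNReal.ofReal (2 / Real.sqrt (2 * Real.pi) * r ω) ∂P := by
  have hcr : Measurable fun ω => (c ω, r ω) := hc.prodMk hr
  have hs : MeasurableSet {q : ℝ × (ℝ × ℝ) | |q.1 - q.2.1| ≤ q.2.2} :=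
    measurableSet_le (by fun_prop) (by fun_prop)
  calc P {ω | |u ω - c ω| ≤ r ω}
      = P.map (fun ω => (u ω, (c ω, r ω))) {q | |q.1 - q.2.1| ≤ q.2.2} :=
        (Measure.map_apply (hu.prodMk hcr) hs).symm
    _ = ∫⁻ q, gaussianReal 0 1 (Metric.closedBall q.1 q.2) ∂(P.map fun ω => (c ω, r ω)) := by
        rw [(indepFun_iff_map_prod_eq_prod_map_map hu.aemeasurable hcr.aemeasurable).1 h,
          hu_dist, Measure.prod_apply_symm hs]
        rfl
    _ ≤ ∫⁻ q, ENNReal.ofReal (2 / Real.sqrt (2 * Real.pi) * q.2) ∂(P.map fun ω => (c ω, r ω)) :=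
        lintegral_mono fun q ↦ gaussianReal_zero_one_closedBall_le q.1 q.2
    _ = ∫⁻ ω, ENNReal.ofReal (2 / Real.sqrt (2 * Real.pi) * r ω) ∂P :=
        lintegral_map (by fun_prop) hcr

/-- **Expected band indicator bound.** If `x` is an integrable random vector in `ℝ^p`,
`α` a real random variable and `u` standard normal and independent of the pair `(x, α)`,
then for every `θ` and `δ ≥ 0`,
`E[1{|u − ⟨x,θ⟩ − α| ≤ ‖x‖δ}] ≤ (2δ/√(2π)) * E‖x‖`. -/
theorem stmt8 {Ω : Type*} [MeasurableSpace Ω] (P : Measure Ω) [IsProbabilityMeasure P]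
    (p : ℕ) (hp : 1 ≤ p)
    (x : Ω → EuclideanSpace ℝ (Fin p)) (α : Ω → ℝ) (u : Ω → ℝ)
    (hx_meas : Measurable x) (hα_meas : Measurable α) (hu_meas : Measurable u)
    (hx_int : Integrable (fun ω => ‖x ω‖) P)
    (hu_dist : Measure.map u P = gaussianReal 0 1)
    (hu_indep : IndepFun u (fun ω => (x ω, α ω)) P)
    (θ : EuclideanSpace ℝ (Fin p)) (δ : ℝ) (hδ : 0 ≤ δ) :
    ∫ ω, (if |u ω - ⟪x ω, θ⟫ - α ω| ≤ ‖x ω‖ * δ then (1 : ℝ) else 0) ∂P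
      ≤ (2 * δ / Real.sqrt (2 * Real.pi)) * ∫ ω, ‖x ω‖ ∂P := by
  have hbound := measure_abs_sub_le_of_indepFun_gaussian (P := P) (u := u)
    (c := fun ω => ⟪x ω, θ⟫ + α ω) (r := fun ω => ‖x ω‖ * δ) hu_meas (by fun_prop) (by fun_prop)
    hu_dist (hu_indep.comp (φ := id) (ψ := fun q : EuclideanSpace ℝ (Fin p) × ℝ =>
      (⟪q.1, θ⟫ + q.2, ‖q.1‖ * δ)) measurable_id (by fun_prop))
  simp only [← sub_sub] at hbound
  have hs : MeasurableSet {ω | |u ω - ⟪x ω, θ⟫ - α ω| ≤ ‖x ω‖ * δ} :=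
    measurableSet_le (by fun_prop) (by fun_prop)
  rw [← ofReal_integral_eq_lintegral_ofReal ((hx_int.mul_const δ).const_mul _)
    (.of_forall fun ω ↦ by positivity), integral_const_mul, integral_mul_const] at hbound
  calc ∫ ω, (if |u ω - ⟪x ω, θ⟫ - α ω| ≤ ‖x ω‖ * δ then (1 : ℝ) else 0) ∂P
      = P.real {ω | |u ω - ⟪x ω, θ⟫ - α ω| ≤ ‖x ω‖ * δ} := by
        rw [← integral_indicator_one hs]
        simp only [Set.indicator_apply, Set.mem_ofPred_eq, Pi.one_apply]
    _ ≤ 2 / Real.sqrt (2 * Real.pi) * ((∫ ω, ‖x ω‖ ∂P) * δ) :=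
        ENNReal.toReal_le_of_le_ofReal (by positivity) hbound
    _ = (2 * δ / Real.sqrt (2 * Real.pi)) * ∫ ω, ‖x ω‖ ∂P := by ring
end

section
/- Averaged L²-smoothness over a countable parameter set: Let p ≥ 1, N ≥ 1, and for k = 1, …, N let x_k : Ω → ℝ^p be integrable random vectors, α_k : Ω → ℝ measurable, and u_k : Ω → ℝ standard normal with u_k independent of the pair (x_k, α_k) for each k. Fix θ₁ ∈ ℝ^p, δ ≥ 0, and a countable subset D of the closed ball {θ₂ ∈ ℝ^p : ‖θ₂ − θ₁‖₂ ≤ δ}. Then E[ sup_{θ₂ ∈ D} ((1/N)∑_{k=1}^N (1{⟨x_k, θ₁⟩ + α_k ≥ u_k} − 1{⟨x_k, θ₂⟩ + α_k ≥ u_k}))² ] ≤ (2δ/√(2π)) · (1/N)∑_{k=1}^N E‖x_k‖₂. -/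
open MeasureTheory ProbabilityTheory Finset
open scoped RealInnerProductSpace

lemma gaussianReal_zero_one_le_volume (s : Set ℝ) :
    gaussianReal 0 1 s ≤ ENNReal.ofReal (1 / Real.sqrt (2 * Real.pi)) * volume s := by
  rw [gaussianReal_apply 0 one_ne_zero s, ← setLIntegral_const]
  refine lintegral_mono fun y => ENNReal.ofReal_le_ofReal ?_
  have hexp : Real.exp (-(y - 0) ^ 2 / (2 * ((1 : NNReal) : ℝ))) ≤ 1 :=
    Real.exp_le_one_iff.2 (by
      have := sq_nonneg (y - 0)
      simp only [NNReal.coe_one]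
      linarith)
  calc gaussianPDFReal 0 1 y
      ≤ (Real.sqrt (2 * Real.pi * ((1 : NNReal) : ℝ)))⁻¹ * 1 :=
        mul_le_mul_of_nonneg_left hexp (by positivity)
    _ = 1 / Real.sqrt (2 * Real.pi) := by simp

/-- Anti-concentration of a standard normal variable in a random band independent of it. -/
lemma measureReal_abs_sub_le_of_indepFun {Ω E : Type*} [MeasurableSpace Ω] {P : Measure Ω}
    [IsProbabilityMeasure P] [MeasurableSpace E] {u : Ω → ℝ} {z : Ω → E} {c r : E → ℝ}
    (hu : Measurable u) (hz : Measurable z) (hc : Measurable c) (hr : Measurable r)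
    (hr_nonneg : ∀ e, 0 ≤ r e) (hr_int : Integrable (fun ω => r (z ω)) P)
    (hu_dist : Measure.map u P = gaussianReal 0 1) (hindep : IndepFun u z P) :
    P.real {ω | |u ω - c (z ω)| ≤ r (z ω)}
      ≤ 2 / Real.sqrt (2 * Real.pi) * ∫ ω, r (z ω) ∂P := by
  have : IsProbabilityMeasure (Measure.map z P) := Measure.isProbabilityMeasure_map hz.aemeasurable
  set B : Set (ℝ × E) := {q | |q.1 - c q.2| ≤ r q.2} with hB
  have hBm : MeasurableSet B := by
    refine measurableSet_le ?_ (hr.comp measurable_snd)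
    exact (measurable_fst.sub (hc.comp measurable_snd)).abs
  have hlaw := (indepFun_iff_map_prod_eq_prod_map_map hu.aemeasurable hz.aemeasurable).1 hindep
  have hprob : P {ω | |u ω - c (z ω)| ≤ r (z ω)}
      ≤ ENNReal.ofReal (∫ ω, 2 / Real.sqrt (2 * Real.pi) * r (z ω) ∂P) := by
    calc P {ω | |u ω - c (z ω)| ≤ r (z ω)}
        = Measure.map (fun ω => (u ω, z ω)) P B := (Measure.map_apply (hu.prodMk hz) hBm).symm
      _ = ∫⁻ e, gaussianReal 0 1 ((fun v => (v, e)) ⁻¹' B) ∂(Measure.map z P) := by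
        rw [hlaw, hu_dist, Measure.prod_apply_symm hBm]
      _ ≤ ∫⁻ e, ENNReal.ofReal (2 / Real.sqrt (2 * Real.pi) * r e) ∂(Measure.map z P) := by
        refine lintegral_mono fun e => ?_
        have hball : (fun v => (v, e)) ⁻¹' B = Metric.closedBall (c e) (r e) := by
          ext v
          simp [hB, Real.dist_eq]
        rw [hball]
        refine (gaussianReal_zero_one_le_volume _).trans (le_of_eq ?_)
        rw [Real.volume_closedBall, ← ENNReal.ofReal_mul (by positivity)]
        congr 1
        ring
      _ = ∫⁻ ω, ENNReal.ofReal (2 / Real.sqrt (2 * Real.pi) * r (z ω)) ∂P :=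
        lintegral_map (hr.const_mul _).ennreal_ofReal hz
      _ = _ := (ofReal_integral_eq_lintegral_ofReal (hr_int.const_mul _)
        (ae_of_all _ fun ω => mul_nonneg (by positivity) (hr_nonneg _))).symm
  rw [← integral_const_mul]
  exact ENNReal.toReal_le_of_le_ofReal
    (integral_nonneg fun ω => mul_nonneg (by positivity) (hr_nonneg _)) hprob

lemma sq_ite_le_sub_ite_le_le_ite {a b v r : ℝ} (hab : |b - a| ≤ r) :
    ((if v ≤ a then (1 : ℝ) else 0) - (if v ≤ b then (1 : ℝ) else 0)) ^ 2
      ≤ if |v - a| ≤ r then 1 else 0 := by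
  have h := abs_le.1 hab
  by_cases hv : |v - a| ≤ r
  · rw [if_pos hv]
    split_ifs <;> norm_num
  · rw [if_neg hv]
    rw [abs_le, not_and_or, not_le, not_le] at hv
    have hr : 0 ≤ r := (abs_nonneg _).trans hab
    split_ifs <;> first | (exfalso; rcases hv with hv | hv <;> linarith) | norm_num

lemma sq_average_le_average_sq {N : ℕ} (f : Fin N → ℝ) :
    ((1 / (N : ℝ)) * ∑ k, f k) ^ 2 ≤ (1 / (N : ℝ)) * ∑ k, f k ^ 2 := by
  rcases Nat.eq_zero_or_pos N with rfl | hN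
  · simp
  have h := sq_sum_le_card_mul_sum_sq (s := Finset.univ) (f := f)
  rw [Finset.card_univ, Fintype.card_fin] at h
  have hN' : (0 : ℝ) < N := by exact_mod_cast hN
  calc ((1 / (N : ℝ)) * ∑ k, f k) ^ 2 = (1 / (N : ℝ)) ^ 2 * (∑ k, f k) ^ 2 := mul_pow _ _ _
    _ ≤ (1 / (N : ℝ)) ^ 2 * (N * ∑ k, f k ^ 2) := by gcongr
    _ = _ := by field_simp

/-- **Averaged L²-smoothness over a countable parameter set.** For `k = 1, …, N` let `x k`
be integrable random vectors in `ℝ^p`, `α k` real random variables, and `u k` standard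
normal with `u k` independent of `(x k, α k)`. Fix `θ₁`, `δ ≥ 0` and a countable subset `D`
of the closed `δ`-ball around `θ₁`. Then
`E[sup_{θ₂ ∈ D} ((1/N) ∑ₖ (1{⟨x k,θ₁⟩ + α k ≥ u k} − 1{⟨x k,θ₂⟩ + α k ≥ u k}))²]
  ≤ (2δ/√(2π)) * (1/N) ∑ₖ E‖x k‖`. -/
theorem stmt9 {Ω : Type*} [MeasurableSpace Ω] (P : Measure Ω) [IsProbabilityMeasure P]
    (p N : ℕ) (hp : 1 ≤ p) (hN : 1 ≤ N)
    (x : Fin N → Ω → EuclideanSpace ℝ (Fin p)) (α : Fin N → Ω → ℝ) (u : Fin N → Ω → ℝ)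
    (hx_meas : ∀ k, Measurable (x k)) (hα_meas : ∀ k, Measurable (α k))
    (hu_meas : ∀ k, Measurable (u k))
    (hx_int : ∀ k, Integrable (fun ω => ‖x k ω‖) P)
    (hu_dist : ∀ k, Measure.map (u k) P = gaussianReal 0 1)
    (hu_indep : ∀ k, IndepFun (u k) (fun ω => (x k ω, α k ω)) P)
    (θ₁ : EuclideanSpace ℝ (Fin p)) (δ : ℝ) (hδ : 0 ≤ δ)
    (D : Set (EuclideanSpace ℝ (Fin p))) (hD_count : D.Countable)
    (hD_ball : D ⊆ Metric.closedBall θ₁ δ) :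
    ∫ ω, (⨆ θ₂ ∈ D,
        ((1 / (N : ℝ)) * ∑ k, ((if u k ω ≤ ⟪x k ω, θ₁⟫ + α k ω then (1 : ℝ) else 0)
          - (if u k ω ≤ ⟪x k ω, θ₂⟫ + α k ω then (1 : ℝ) else 0))) ^ 2) ∂P
      ≤ (2 * δ / Real.sqrt (2 * Real.pi)) * ((1 / (N : ℝ)) * ∑ k, ∫ ω, ‖x k ω‖ ∂P) := by
  set S : Fin N → Set Ω := fun k => {ω | |u k ω - (⟪x k ω, θ₁⟫ + α k ω)| ≤ ‖x k ω‖ * δ} with hS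
  have hSm : ∀ k, MeasurableSet (S k) := fun k =>
    measurableSet_le ((hu_meas k).sub (((hx_meas k).inner_const).add (hα_meas k))).abs
      ((hx_meas k).norm.mul_const δ)
  have hS_int : ∀ k, Integrable ((S k).indicator (fun _ => (1 : ℝ))) P := fun k =>
    (integrable_const 1).indicator (hSm k)
  have hS_prob : ∀ k, P.real (S k)
      ≤ 2 / Real.sqrt (2 * Real.pi) * ∫ ω, ‖x k ω‖ * δ ∂P := fun k =>
    measureReal_abs_sub_le_of_indepFun (z := fun ω => (x k ω, α k ω))
      (c := fun e => ⟪e.1, θ₁⟫ + e.2) (r := fun e => ‖e.1‖ * δ) (hu_meas k)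
      ((hx_meas k).prodMk (hα_meas k)) (by fun_prop) (by fun_prop)
      (fun e => mul_nonneg (norm_nonneg _) hδ) ((hx_int k).mul_const δ) (hu_dist k) (hu_indep k)
  calc _ ≤ ∫ ω, (1 / (N : ℝ)) * ∑ k, (S k).indicator (fun _ => (1 : ℝ)) ω ∂P := by
        refine integral_mono_of_nonneg
          (ae_of_all _ fun ω => Real.iSup_nonneg fun θ₂ => Real.iSup_nonneg fun _ => sq_nonneg _)
          ((integrable_finsetSum _ fun k _ => hS_int k).const_mul _) (ae_of_all _ fun ω => ?_)
        have hnonneg : 0 ≤ (1 / (N : ℝ)) * ∑ k, (S k).indicator (fun _ => (1 : ℝ)) ω :=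
          mul_nonneg (by positivity)
            (Finset.sum_nonneg fun k _ => Set.indicator_nonneg (fun _ _ => zero_le_one) _)
        refine Real.iSup_le (fun θ₂ => Real.iSup_le (fun hθ₂ => ?_) hnonneg) hnonneg
        refine (sq_average_le_average_sq _).trans ?_
        refine mul_le_mul_of_nonneg_left (Finset.sum_le_sum fun k _ => ?_) (by positivity)
        refine (sq_ite_le_sub_ite_le_le_ite (r := ‖x k ω‖ * δ) ?_).trans (le_of_eq ?_)
        · rw [add_sub_add_right_eq_sub, ← inner_sub_right]
          refine (abs_real_inner_le_norm _ _).trans ?_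
          gcongr
          exact mem_closedBall_iff_norm.1 (hD_ball hθ₂)
        · simp [hS, Set.indicator_apply]
    _ = (1 / (N : ℝ)) * ∑ k, P.real (S k) := by
        rw [integral_const_mul, integral_finsetSum _ fun k _ => hS_int k]
        simp only [integral_indicator_const _ (hSm _), smul_eq_mul, mul_one]
    _ ≤ (1 / (N : ℝ)) * ∑ k, 2 / Real.sqrt (2 * Real.pi) * ∫ ω, ‖x k ω‖ * δ ∂P := by
        gcongr with k
        exact hS_prob k
    _ = _ := by
        simp only [integral_mul_const, Finset.mul_sum]
        exact Finset.sum_congr rfl fun k _ => by ring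
end
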